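/- Let H be a real Hilbert space and C a nonempty closed convex subset of H. Let f : C × C → ℝ be a bifunction satisfying conditions (A1)–(A4), A : C → H a continuous monotone map, and T : C → H a closed generalized nonexpansive map such that B := F(T) ∩ EP(f) ∩ VI(C,A) ≠ ∅. Fix α₁, α₂, α₃ ∈ (0,1) with α₁+α₂+α₃ = 1, a > 0 and real numbers r_n ≥ a. Define the sequence (x_n) by: x₁ = x ∈ C, C₁ = C, and for n ≥ 1: z_n is the point of C satisfying f(z_n, y) + (1/r_n)⟨y − z_n, z_n − x_n⟩ ≥ 0 for all y ∈ C; u_n is the point of C satisfying ⟨y − u_n, A u_n⟩ + (1/r_n)⟨y − u_n, u_n − x_n⟩ ≥ 0 for all y ∈ C; y_n = α₁x_n + α₂z_n + α₃T u_n; C_{n+1} = {z ∈ C_n : ‖z − y_n‖ ≤ ‖z − x_n‖}; and x_{n+1} = P_{C_{n+1}} x. Then B is a nonempty closed convex set and (x_n) converges strongly to P_B x. -/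

import Mathlib

open scoped RealInnerProductSpace

theorem LowerSemicontinuousOn.le_of_tendsto {X : Type*} [TopologicalSpace X] {C : Set X}
    {φ : X → ℝ} (hφ : LowerSemicontinuousOn φ C)
    {z : ℕ → X} (hz : ∀ n, z n ∈ C) {p : X} (hp : p ∈ C)
    (hlim : Filter.Tendsto z Filter.atTop (nhds p)) {ε : ℕ → ℝ} {c : ℝ}
    (hε : Filter.Tendsto ε Filter.atTop (nhds c)) (hle : ∀ n, φ (z n) ≤ ε n) : φ p ≤ c := by
  by_contra! h
  obtain ⟨d, hcd, hd⟩ := exists_between h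
  have hz' : Filter.Tendsto z Filter.atTop (nhdsWithin p C) :=
    tendsto_nhdsWithin_iff.2 ⟨hlim, Filter.Eventually.of_forall hz⟩
  obtain ⟨n, h1, h2⟩ :=
    ((hz'.eventually (hφ p hp d hd)).and (hε.eventually_lt_const hcd)).exists
  exact absurd (hle n) (by linarith)

theorem tendsto_of_mul_norm_sub_sq_le {E : Type*} [NormedAddCommGroup E] {x z : ℕ → E}
    {p : E} {c : ℝ} (hc : 0 < c) {δ : ℕ → ℝ}
    (hx : Filter.Tendsto x Filter.atTop (nhds p)) (hδ : Filter.Tendsto δ Filter.atTop (nhds 0))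
    (h : ∀ n, c * ‖x n - z n‖ ^ 2 ≤ δ n) : Filter.Tendsto z Filter.atTop (nhds p) := by
  have h1 : Filter.Tendsto (fun n => ‖x n - z n‖ ^ 2) Filter.atTop (nhds 0) := by
    refine squeeze_zero (fun n => by positivity) (fun n => ?_) (by simpa using hδ.const_mul c⁻¹)
    rw [inv_mul_eq_div, le_div_iff₀ hc, mul_comm]
    exact h n
  have h2 : Filter.Tendsto (fun n => ‖x n - z n‖) Filter.atTop (nhds 0) := by
    simpa [Real.sqrt_sq] using h1.sqrt
  simpa using hx.sub (tendsto_zero_iff_norm_tendsto_zero.2 h2)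

theorem isClosed_dual {E : Type*} [NormedAddCommGroup E] {C : Set E} {g : E → E → ℝ}
    (hCcl : IsClosed C) (h4 : ∀ x ∈ C, LowerSemicontinuousOn (g x) C) :
    IsClosed {p ∈ C | ∀ y ∈ C, g y p ≤ 0} := by
  refine IsSeqClosed.isClosed fun z p hz hlim => ?_
  have hp : p ∈ C := hCcl.mem_of_tendsto hlim (Filter.Eventually.of_forall fun n => (hz n).1)
  exact ⟨hp, fun y hy => (h4 y hy).le_of_tendsto (fun n => (hz n).1) hp hlim tendsto_const_nhds
    fun n => (hz n).2 y hy⟩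

section Equilibrium

variable {H : Type*} [NormedAddCommGroup H] [InnerProductSpace ℝ H] {C : Set H} {g : H → H → ℝ}

/-- Minty's lemma for bifunctions: under hemicontinuity in the first variable and convexity in the
second one, a solution of the dual equilibrium problem solves the primal one. -/
theorem equilibrium_of_dual (hC : Convex ℝ C) (h1 : ∀ x ∈ C, g x x = 0)
    (h3 : ∀ x ∈ C, ∀ y ∈ C, ∀ z ∈ C,
      Filter.limsup (fun t : ℝ => g (t • z + (1 - t) • x) y) (nhdsWithin 0 (Set.Ioi 0)) ≤ g x y)
    (h4 : ∀ x ∈ C, ConvexOn ℝ C (g x)) {p : H} (hp : p ∈ C) (hdual : ∀ y ∈ C, g y p ≤ 0) :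
    ∀ y ∈ C, 0 ≤ g p y := by
  intro y hy
  refine le_trans ?_ (h3 p hp y hy y hy)
  have hev : ∀ᶠ t : ℝ in nhdsWithin 0 (Set.Ioi 0), 0 ≤ g (t • y + (1 - t) • p) y := by
    filter_upwards [Ioo_mem_nhdsGT (zero_lt_one' ℝ)] with t ht
    obtain ⟨ht0, ht1⟩ := ht
    have hw : t • y + (1 - t) • p ∈ C := hC hy hp ht0.le (by linarith) (by ring)
    have hc := (h4 _ hw).2 hy hp ht0.le (by linarith : 0 ≤ 1 - t) (by ring)
    rw [h1 _ hw, smul_eq_mul, smul_eq_mul] at hc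
    have hd := mul_nonpos_of_nonneg_of_nonpos (by linarith : 0 ≤ 1 - t) (hdual _ hw)
    exact nonneg_of_mul_nonneg_right (by linarith) ht0
  rw [Filter.limsup_eq]
  refine Real.sInf_nonneg fun b hb => ?_
  obtain ⟨t, h0, hb⟩ := (hev.and hb).exists
  exact h0.trans hb

/-- The equilibrium problem for a monotone bifunction and its dual have the same solutions. -/
theorem equilibrium_eq_dual (hC : Convex ℝ C) (h1 : ∀ x ∈ C, g x x = 0)
    (h2 : ∀ x ∈ C, ∀ y ∈ C, g x y + g y x ≤ 0)
    (h3 : ∀ x ∈ C, ∀ y ∈ C, ∀ z ∈ C,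
      Filter.limsup (fun t : ℝ => g (t • z + (1 - t) • x) y) (nhdsWithin 0 (Set.Ioi 0)) ≤ g x y)
    (h4 : ∀ x ∈ C, ConvexOn ℝ C (g x)) :
    {p ∈ C | ∀ y ∈ C, 0 ≤ g p y} = {p ∈ C | ∀ y ∈ C, g y p ≤ 0} := by
  ext p
  refine ⟨fun h => ⟨h.1, fun y hy => ?_⟩, fun h => ⟨h.1, equilibrium_of_dual hC h1 h3 h4 h.1 h.2⟩⟩
  linarith [h2 p h.1 y hy, h.2 y hy]

theorem convex_dual (hC : Convex ℝ C) (h4 : ∀ x ∈ C, ConvexOn ℝ C (g x)) :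
    Convex ℝ {p ∈ C | ∀ y ∈ C, g y p ≤ 0} := by
  intro p hp q hq a b ha hb hab
  exact ⟨hC hp.1 hq.1 ha hb hab, fun y hy =>
    ((h4 y hy).convex_le 0 ⟨hp.1, hp.2 y hy⟩ ⟨hq.1, hq.2 y hy⟩ ha hb hab).2⟩

/-- The resolvent of a monotone bifunction is quasi-firmly nonexpansive. -/
theorem resolvent_norm_sq_le (h2 : ∀ x ∈ C, ∀ y ∈ C, g x y + g y x ≤ 0) {r : ℝ} (hr : 0 < r)
    {x z w : H} (hz : z ∈ C) (hres : ∀ y ∈ C, 0 ≤ g z y + (1 / r) * ⟪y - z, z - x⟫)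
    (hw : w ∈ C) (hsol : ∀ y ∈ C, 0 ≤ g w y) :
    ‖z - w‖ ^ 2 + ‖x - z‖ ^ 2 ≤ ‖x - w‖ ^ 2 := by
  have h : 0 ≤ (1 / r) * ⟪w - z, z - x⟫ := by
    linarith [hres w hw, h2 z hz w hw, hsol z hz]
  have h' : 0 ≤ ⟪w - z, z - x⟫ := nonneg_of_mul_nonneg_right h (by positivity)
  have e : x - w = -((w - z) + (z - x)) := by abel
  rw [e, norm_neg, norm_add_sq_real, norm_sub_rev z w, norm_sub_rev x z]
  linarith

/-- If resolvent points `z n` of points `x n` and the `x n` themselves have the same limit, then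
this limit solves the dual equilibrium problem. -/
theorem dual_of_tendsto_resolvent (h2 : ∀ x ∈ C, ∀ y ∈ C, g x y + g y x ≤ 0)
    (h4 : ∀ x ∈ C, LowerSemicontinuousOn (g x) C) {a : ℝ} (ha : 0 < a) {r : ℕ → ℝ}
    (hr : ∀ n, a ≤ r n) {x z : ℕ → H} {p : H} (hp : p ∈ C)
    (hres : ∀ n, z n ∈ C ∧ ∀ y ∈ C, 0 ≤ g (z n) y + (1 / r n) * ⟪y - z n, z n - x n⟫)
    (hz : Filter.Tendsto z Filter.atTop (nhds p)) (hx : Filter.Tendsto x Filter.atTop (nhds p)) :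
    ∀ y ∈ C, g y p ≤ 0 := by
  intro y hy
  have hε : Filter.Tendsto (fun n => (1 / a) * (‖y - z n‖ * ‖z n - x n‖)) Filter.atTop
      (nhds 0) := by
    simpa using (((tendsto_const_nhds (x := y)).sub hz).norm.mul (hz.sub hx).norm).const_mul (1 / a)
  refine (h4 y hy).le_of_tendsto (fun n => (hres n).1) hp hz hε fun n => ?_
  have hrn : 0 < r n := ha.trans_le (hr n)
  have h1 : (1 / r n) * ⟪y - z n, z n - x n⟫ ≤ (1 / a) * (‖y - z n‖ * ‖z n - x n‖) :=
    (mul_le_mul_of_nonneg_left (real_inner_le_norm _ _) (by positivity)).trans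
      (mul_le_mul_of_nonneg_right (one_div_le_one_div_of_le ha (hr n)) (by positivity))
  linarith [(hres n).2 y hy, h2 (z n) (hres n).1 y hy]

end Equilibrium

section VariationalInequality

variable {H : Type*} [NormedAddCommGroup H] [InnerProductSpace ℝ H] {C : Set H} {A : H → H}

theorem variational_bifunction_monotone (hA : ∀ u ∈ C, ∀ v ∈ C, 0 ≤ ⟪u - v, A u - A v⟫) :
    ∀ u ∈ C, ∀ v ∈ C, ⟪v - u, A u⟫ + ⟪u - v, A v⟫ ≤ 0 := by
  intro u hu v hv
  have h := hA u hu v hv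
  rw [inner_sub_right] at h
  rw [← neg_sub u v, inner_neg_left]
  linarith

theorem variational_bifunction_limsup_le (hC : Convex ℝ C) (hA : ContinuousOn A C) :
    ∀ u ∈ C, ∀ v ∈ C, ∀ w ∈ C,
      Filter.limsup (fun t : ℝ => ⟪v - (t • w + (1 - t) • u), A (t • w + (1 - t) • u)⟫)
        (nhdsWithin 0 (Set.Ioi 0)) ≤ ⟪v - u, A u⟫ := by
  intro u hu v _ w hw
  have hlim : Filter.Tendsto (fun t : ℝ => t • w + (1 - t) • u) (nhdsWithin 0 (Set.Ioi 0))
      (nhds u) := by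
    have hc : Continuous fun t : ℝ => t • w + (1 - t) • u := by fun_prop
    simpa using (hc.tendsto 0).mono_left nhdsWithin_le_nhds
  have hlim' : Filter.Tendsto (fun t : ℝ => t • w + (1 - t) • u) (nhdsWithin 0 (Set.Ioi 0))
      (nhdsWithin u C) := by
    refine tendsto_nhdsWithin_iff.2 ⟨hlim, ?_⟩
    filter_upwards [Ioo_mem_nhdsGT (zero_lt_one' ℝ)] with t ht
    exact hC hw hu ht.1.le (by linarith [ht.2]) (by ring)
  exact ((hlim.const_sub v).inner ((hA u hu).tendsto.comp hlim')).limsup_eq.le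

theorem variational_bifunction_convexOn (hC : Convex ℝ C) (u : H) :
    ConvexOn ℝ C fun v => ⟪v - u, A u⟫ := by
  refine ⟨hC, fun v _ w _ a b _ _ hab => le_of_eq ?_⟩
  obtain rfl : b = 1 - a := by linarith
  simp only [inner_sub_left, inner_add_left, real_inner_smul_left, smul_eq_mul]
  ring

theorem variational_bifunction_lowerSemicontinuousOn (u : H) :
    LowerSemicontinuousOn (fun v => ⟪v - u, A u⟫) C :=
  (show Continuous fun v => ⟪v - u, A u⟫ by fun_prop).lowerSemicontinuous.lowerSemicontinuousOn C

end VariationalInequality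

section Geometry

variable {H : Type*} [NormedAddCommGroup H] [InnerProductSpace ℝ H]

theorem convex_comb_norm_sq (p q v : H) {a b : ℝ} (hab : a + b = 1) :
    a * ‖v - p‖ ^ 2 + b * ‖v - q‖ ^ 2 = ‖v - (a • p + b • q)‖ ^ 2 + a * b * ‖p - q‖ ^ 2 := by
  obtain rfl : b = 1 - a := by linarith
  simp only [norm_sub_sq_real, norm_add_sq_real, inner_add_right, real_inner_smul_left,
    real_inner_smul_right, norm_smul, mul_pow, Real.norm_eq_abs, sq_abs]
  ring

theorem norm_sq_convex_comb_three_le (p q s : H) {a b c : ℝ} (ha : 0 ≤ a) (hb : 0 ≤ b)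
    (hc : 0 ≤ c) (habc : a + b + c = 1) :
    ‖a • p + b • q + c • s‖ ^ 2 + a * c * ‖p - s‖ ^ 2 ≤
      a * ‖p‖ ^ 2 + b * ‖q‖ ^ 2 + c * ‖s‖ ^ 2 := by
  have h : a * ‖p‖ ^ 2 + b * ‖q‖ ^ 2 + c * ‖s‖ ^ 2 -
      (‖a • p + b • q + c • s‖ ^ 2 + a * c * ‖p - s‖ ^ 2) =
      a * b * ‖p - q‖ ^ 2 + b * c * ‖q - s‖ ^ 2 := by
    obtain rfl : c = 1 - a - b := by linarith
    simp only [norm_sub_sq_real, norm_add_sq_real, inner_add_left, real_inner_smul_left,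
      real_inner_smul_right, norm_smul, mul_pow, Real.norm_eq_abs, sq_abs]
    ring
  have : 0 ≤ a * b * ‖p - q‖ ^ 2 + b * c * ‖q - s‖ ^ 2 := by positivity
  linarith

theorem norm_sub_le_iff_inner (z x y : H) :
    ‖z - y‖ ≤ ‖z - x‖ ↔ 2 * ⟪x - y, z⟫ ≤ ‖x‖ ^ 2 - ‖y‖ ^ 2 := by
  rw [← sq_le_sq₀ (norm_nonneg _) (norm_nonneg _), norm_sub_sq_real, norm_sub_sq_real,
    inner_sub_left, real_inner_comm z x, real_inner_comm z y]
  constructor <;> intro h <;> linarith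

theorem convex_norm_sub_le (x y : H) : Convex ℝ {z : H | ‖z - y‖ ≤ ‖z - x‖} := by
  intro z hz w hw a b ha hb hab
  simp only [Set.mem_ofPred_eq, norm_sub_le_iff_inner] at hz hw ⊢
  rw [inner_add_right, real_inner_smul_right, real_inner_smul_right]
  obtain rfl : b = 1 - a := by linarith
  nlinarith [mul_le_mul_of_nonneg_left hz ha, mul_le_mul_of_nonneg_left hw hb]

theorem norm_sq_add_norm_sq_le_of_nearest {K : Set H} (hK : Convex ℝ K) {x p w : H} (hp : p ∈ K)
    (hmin : ∀ v ∈ K, ‖x - p‖ ≤ ‖x - v‖) (hw : w ∈ K) :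
    ‖w - p‖ ^ 2 + ‖x - p‖ ^ 2 ≤ ‖x - w‖ ^ 2 := by
  have hinf : ‖x - p‖ = ⨅ v : K, ‖x - v‖ := by
    have : Nonempty K := ⟨⟨p, hp⟩⟩
    refine le_antisymm (le_ciInf fun v => hmin v v.2) ?_
    exact ciInf_le ⟨0, by rintro _ ⟨v, rfl⟩; exact norm_nonneg _⟩ (⟨p, hp⟩ : K)
  have h := (norm_eq_iInf_iff_real_inner_le_zero hK hp).1 hinf w hw
  have e : x - w = (x - p) - (w - p) := by abel
  rw [e, norm_sub_sq_real (x - p) (w - p)]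
  linarith

/-- The fixed point set of a generalized nonexpansive map on a convex set is convex. -/
theorem convex_fixedPoints {C : Set H} (hC : Convex ℝ C) {T : H → H}
    (hT : ∀ w ∈ C, ∀ p ∈ {p ∈ C | T p = p}, ‖T w - p‖ ≤ ‖w - p‖) :
    Convex ℝ {p ∈ C | T p = p} := by
  intro p hp q hq a b ha hb hab
  have hz : a • p + b • q ∈ C := hC hp.1 hq.1 ha hb hab
  refine ⟨hz, ?_⟩
  have h1 := pow_le_pow_left₀ (norm_nonneg _) (hT _ hz p hp) 2
  have h2 := pow_le_pow_left₀ (norm_nonneg _) (hT _ hz q hq) 2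
  have e1 := convex_comb_norm_sq p q (T (a • p + b • q)) hab
  have e2 := convex_comb_norm_sq p q (a • p + b • q) hab
  rw [sub_self, norm_zero] at e2
  have h : ‖T (a • p + b • q) - (a • p + b • q)‖ ^ 2 ≤ 0 := by
    nlinarith [mul_le_mul_of_nonneg_left h1 ha, mul_le_mul_of_nonneg_left h2 hb]
  have h0 : ‖T (a • p + b • q) - (a • p + b • q)‖ = 0 :=
    pow_eq_zero_iff two_ne_zero |>.1 (le_antisymm h (by positivity))
  exact sub_eq_zero.1 (norm_eq_zero.1 h0)

/-- Successive nearest points to `x` in a decreasing sequence of convex sets form a Cauchy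
sequence, provided the distances to `x` are bounded. -/
theorem cauchySeq_of_nearest {K : ℕ → Set H} (hK : ∀ n, Convex ℝ (K n)) (hanti : Antitone K)
    {x : H} {p : ℕ → H} (hp : ∀ n, p n ∈ K n) (hmin : ∀ n, ∀ v ∈ K n, ‖x - p n‖ ≤ ‖x - v‖)
    {M : ℝ} (hM : ∀ n, ‖x - p n‖ ≤ M) : CauchySeq p := by
  have key : ∀ m n, m ≤ n → ‖p n - p m‖ ^ 2 ≤ ‖x - p n‖ ^ 2 - ‖x - p m‖ ^ 2 := fun m n hmn => by
    linarith [norm_sq_add_norm_sq_le_of_nearest (hK m) (hp m) (hmin m) (hanti hmn (hp n))]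
  have hmono : Monotone fun n => ‖x - p n‖ ^ 2 := fun m n hmn => by
    have := key m n hmn
    dsimp only
    nlinarith [sq_nonneg ‖p n - p m‖]
  have hbdd : BddAbove (Set.range fun n => ‖x - p n‖ ^ 2) :=
    ⟨M ^ 2, by rintro _ ⟨n, rfl⟩; exact pow_le_pow_left₀ (norm_nonneg _) (hM n) 2⟩
  have hcau := (tendsto_atTop_ciSup hmono hbdd).cauchySeq
  rw [Metric.cauchySeq_iff'] at hcau ⊢
  intro ε hε
  obtain ⟨N, hN⟩ := hcau (ε ^ 2) (by positivity)
  refine ⟨N, fun n hn => ?_⟩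
  have h := hN n hn
  rw [Real.dist_eq] at h
  rw [dist_eq_norm]
  exact lt_of_pow_lt_pow_left₀ 2 hε.le
    ((key N n hn).trans_lt ((le_abs_self _).trans_lt h))

end Geometry

/-- Hilbert-space case of Corollary 4.1 of the paper; indices relabelled to
start at `0`: for a single bifunction `f` satisfying (A1)–(A4), a single continuous monotone map
`A`, and a single closed generalized nonexpansive map `T` with
`B := F(T) ∩ EP(f) ∩ VI(C,A) ≠ ∅`, the set `B` is closed and convex and the hybrid sequence
`(xₙ)` converges strongly to `P_B x`. -/
theorem statement18 (H : Type*) [NormedAddCommGroup H] [InnerProductSpace ℝ H] [CompleteSpace H]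
    (C : Set H) (hCne : C.Nonempty) (hCclosed : IsClosed C) (hCconv : Convex ℝ C)
    (f : H → H → ℝ)
    (hA1 : ∀ x ∈ C, f x x = 0)
    (hA2 : ∀ x ∈ C, ∀ y ∈ C, f x y + f y x ≤ 0)
    (hA3 : ∀ x ∈ C, ∀ y ∈ C, ∀ z ∈ C,
      Filter.limsup (fun t : ℝ => f (t • z + (1 - t) • x) y) (nhdsWithin 0 (Set.Ioi 0)) ≤ f x y)
    (hA4 : ∀ x ∈ C, ConvexOn ℝ C (f x) ∧ LowerSemicontinuousOn (f x) C)
    (A : H → H) (hAcont : ContinuousOn A C)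
    (hAmono : ∀ u ∈ C, ∀ v ∈ C, 0 ≤ ⟪u - v, A u - A v⟫)
    (T : H → H)
    -- T is generalized nonexpansive:
    (hTfix : {p ∈ C | T p = p}.Nonempty)
    (hTgen : ∀ w ∈ C, ∀ p ∈ {p ∈ C | T p = p}, ‖T w - p‖ ≤ ‖w - p‖)
    -- T is a closed map:
    (hTclosed : ∀ u : ℕ → H, (∀ n, u n ∈ C) → ∀ p ∈ C,
      Filter.Tendsto u Filter.atTop (nhds p) →
      ∀ q : H, Filter.Tendsto (fun n => T (u n)) Filter.atTop (nhds q) → T p = q)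
    (B : Set H)
    (hB : B = {p ∈ C | T p = p} ∩ {p ∈ C | ∀ y ∈ C, 0 ≤ f p y} ∩
        {p ∈ C | ∀ y ∈ C, 0 ≤ ⟪y - p, A p⟫})
    (hBne : B.Nonempty)
    (α₁ α₂ α₃ : ℝ)
    (hα₁ : α₁ ∈ Set.Ioo (0 : ℝ) 1) (hα₂ : α₂ ∈ Set.Ioo (0 : ℝ) 1)
    (hα₃ : α₃ ∈ Set.Ioo (0 : ℝ) 1) (hαsum : α₁ + α₂ + α₃ = 1)
    (a : ℝ) (ha : 0 < a) (rn : ℕ → ℝ) (hrn : ∀ n, a ≤ rn n)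
    (x : H) (hx : x ∈ C)
    (xseq zseq useq yseq : ℕ → H) (Cset : ℕ → Set H)
    (hx0 : xseq 0 = x) (hC0 : Cset 0 = C)
    (hzseq : ∀ n, zseq n ∈ C ∧ ∀ y ∈ C,
      0 ≤ f (zseq n) y + (1 / rn n) * ⟪y - zseq n, zseq n - xseq n⟫)
    (huseq : ∀ n, useq n ∈ C ∧ ∀ y ∈ C,
      0 ≤ ⟪y - useq n, A (useq n)⟫ + (1 / rn n) * ⟪y - useq n, useq n - xseq n⟫)
    (hyseq : ∀ n, yseq n = α₁ • xseq n + α₂ • zseq n + α₃ • T (useq n))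
    (hCrec : ∀ n, Cset (n + 1) = {z ∈ Cset n | ‖z - yseq n‖ ≤ ‖z - xseq n‖})
    -- xₙ₊₁ = P_{Cₙ₊₁} x :
    (hxnext : ∀ n, xseq (n + 1) ∈ Cset (n + 1) ∧
      ∀ w ∈ Cset (n + 1), ‖x - xseq (n + 1)‖ ≤ ‖x - w‖) :
    (IsClosed B ∧ Convex ℝ B) ∧
      ∃ p : H, p ∈ B ∧ (∀ w ∈ B, ‖x - p‖ ≤ ‖x - w‖) ∧
        Filter.Tendsto xseq Filter.atTop (nhds p) := by
  have hf4 : ∀ u ∈ C, ConvexOn ℝ C (f u) := fun u hu => (hA4 u hu).1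
  have hfl : ∀ u ∈ C, LowerSemicontinuousOn (f u) C := fun u hu => (hA4 u hu).2
  let g : H → H → ℝ := fun u v => ⟪v - u, A u⟫
  have hg1 : ∀ u ∈ C, g u u = 0 := fun u _ => by simp [g]
  have hg2 : ∀ u ∈ C, ∀ v ∈ C, g u v + g v u ≤ 0 := variational_bifunction_monotone hAmono
  have hg3 : ∀ u ∈ C, ∀ v ∈ C, ∀ w ∈ C, Filter.limsup
      (fun t : ℝ => g (t • w + (1 - t) • u) v) (nhdsWithin 0 (Set.Ioi 0)) ≤ g u v :=
    variational_bifunction_limsup_le hCconv hAcont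
  have hg4 : ∀ u ∈ C, ConvexOn ℝ C (g u) := fun u _ => variational_bifunction_convexOn hCconv u
  have hgl : ∀ u ∈ C, LowerSemicontinuousOn (g u) C :=
    fun u _ => variational_bifunction_lowerSemicontinuousOn u
  have hEP := equilibrium_eq_dual hCconv hA1 hA2 hA3 hf4
  have hVI : {p ∈ C | ∀ y ∈ C, 0 ≤ ⟪y - p, A p⟫} = {p ∈ C | ∀ y ∈ C, g y p ≤ 0} :=
    equilibrium_eq_dual hCconv hg1 hg2 hg3 hg4
  have hFcl : IsClosed {p ∈ C | T p = p} := by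
    refine IsSeqClosed.isClosed fun u p hu hlim => ?_
    have hp : p ∈ C := hCclosed.mem_of_tendsto hlim (Filter.Eventually.of_forall fun n => (hu n).1)
    exact ⟨hp, hTclosed u (fun n => (hu n).1) p hp hlim p (by simpa only [(hu _).2] using hlim)⟩
  refine ⟨?_, ?_⟩
  · rw [hB, hEP, hVI]
    exact ⟨(hFcl.inter (isClosed_dual hCclosed hfl)).inter (isClosed_dual hCclosed hgl),
      ((convex_fixedPoints hCconv hTgen).inter (convex_dual hCconv hf4)).inter (convex_dual hCconv hg4)⟩
  obtain ⟨hα₁, -⟩ := hα₁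
  obtain ⟨hα₂, -⟩ := hα₂
  obtain ⟨hα₃, -⟩ := hα₃
  have hanti : Antitone Cset := antitone_nat_of_succ_le fun n => by
    rw [hCrec n]; exact fun z hz => hz.1
  have hsubC : ∀ n, Cset n ⊆ C := fun n => hC0 ▸ hanti (Nat.zero_le n)
  have hconv : ∀ n, Convex ℝ (Cset n) := by
    intro n
    induction n with
    | zero => rwa [hC0]
    | succ n ih => rw [hCrec n]; exact ih.inter (convex_norm_sub_le _ _)
  have hxmem : ∀ n, xseq n ∈ Cset n
    | 0 => by rwa [hx0, hC0]
    | n + 1 => (hxnext n).1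
  have hxmin : ∀ n, ∀ v ∈ Cset n, ‖x - xseq n‖ ≤ ‖x - v‖
    | 0 => fun v _ => by simp [hx0]
    | n + 1 => (hxnext n).2
  have hest : ∀ w ∈ B, ∀ n, ‖yseq n - w‖ ^ 2 + α₂ * ‖xseq n - zseq n‖ ^ 2 +
      α₃ * ‖xseq n - useq n‖ ^ 2 + α₁ * α₃ * ‖xseq n - T (useq n)‖ ^ 2 ≤ ‖xseq n - w‖ ^ 2 := by
    intro w hw n
    rw [hB] at hw
    obtain ⟨⟨hwF, hwE⟩, hwV⟩ := hw
    have hr : 0 < rn n := ha.trans_le (hrn n)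
    have hz := resolvent_norm_sq_le hA2 hr (hzseq n).1 (hzseq n).2 hwE.1 hwE.2
    have hu := resolvent_norm_sq_le hg2 hr (huseq n).1 (huseq n).2 hwV.1 hwV.2
    have hT := pow_le_pow_left₀ (norm_nonneg _) (hTgen _ (huseq n).1 w hwF) 2
    have hcomb := norm_sq_convex_comb_three_le (xseq n - w) (zseq n - w) (T (useq n) - w)
      hα₁.le hα₂.le hα₃.le hαsum
    have e : α₁ • (xseq n - w) + α₂ • (zseq n - w) + α₃ • (T (useq n) - w) = yseq n - w := by
      rw [hyseq n]
      obtain rfl : α₃ = 1 - α₁ - α₂ := by linarith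
      module
    rw [e, sub_sub_sub_cancel_right] at hcomb
    have hs : α₁ * ‖xseq n - w‖ ^ 2 + α₂ * ‖xseq n - w‖ ^ 2 + α₃ * ‖xseq n - w‖ ^ 2 =
        ‖xseq n - w‖ ^ 2 := by rw [← add_mul, ← add_mul, hαsum, one_mul]
    linarith [mul_le_mul_of_nonneg_left hz hα₂.le,
      mul_le_mul_of_nonneg_left (hT.trans (le_sub_iff_add_le.2 hu)) hα₃.le]
  have hBsub : ∀ w ∈ B, ∀ n, w ∈ Cset n := by
    intro w hw n
    induction n with
    | zero => rw [hC0]; rw [hB] at hw; exact hw.2.1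
    | succ n ih =>
      rw [hCrec n]
      refine ⟨ih, ?_⟩
      rw [norm_sub_rev w, norm_sub_rev w, ← sq_le_sq₀ (norm_nonneg _) (norm_nonneg _)]
      have : 0 ≤ α₂ * ‖xseq n - zseq n‖ ^ 2 + α₃ * ‖xseq n - useq n‖ ^ 2 +
        α₁ * α₃ * ‖xseq n - T (useq n)‖ ^ 2 := by positivity
      linarith [hest w hw n]
  obtain ⟨w, hw⟩ := hBne
  obtain ⟨p, hxp⟩ := cauchySeq_tendsto_of_complete
    (cauchySeq_of_nearest hconv hanti hxmem hxmin fun n => hxmin n w (hBsub w hw n))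
  have hpC : p ∈ C :=
    hCclosed.mem_of_tendsto hxp (Filter.Eventually.of_forall fun n => hsubC n (hxmem n))
  have hxp' : Filter.Tendsto (fun n => xseq (n + 1)) Filter.atTop (nhds p) :=
    hxp.comp (Filter.tendsto_add_atTop_nat 1)
  have hyp : Filter.Tendsto yseq Filter.atTop (nhds p) := by
    have h0 : Filter.Tendsto (fun n => xseq (n + 1) - yseq n) Filter.atTop (nhds 0) := by
      refine squeeze_zero_norm (a := fun n => ‖xseq (n + 1) - xseq n‖) (fun n => ?_)
        (by simpa using (hxp'.sub hxp).norm)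
      have h := (hxnext n).1
      rw [hCrec n] at h
      exact h.2
    simpa using hxp'.sub h0
  have hδ : Filter.Tendsto (fun n => ‖xseq n - w‖ ^ 2 - ‖yseq n - w‖ ^ 2) Filter.atTop
      (nhds 0) := by
    simpa using ((hxp.sub_const w).norm.pow 2).sub ((hyp.sub_const w).norm.pow 2)
  have hz0 : ∀ n, 0 ≤ α₂ * ‖xseq n - zseq n‖ ^ 2 := fun n => by positivity
  have hu0 : ∀ n, 0 ≤ α₃ * ‖xseq n - useq n‖ ^ 2 := fun n => by positivity
  have hT0 : ∀ n, 0 ≤ α₁ * α₃ * ‖xseq n - T (useq n)‖ ^ 2 := fun n => by positivity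
  have hzp := tendsto_of_mul_norm_sub_sq_le (z := zseq) hα₂ hxp hδ
    fun n => by linarith [hest w hw n, hu0 n, hT0 n]
  have hup := tendsto_of_mul_norm_sub_sq_le (z := useq) hα₃ hxp hδ
    fun n => by linarith [hest w hw n, hz0 n, hT0 n]
  have hTp := tendsto_of_mul_norm_sub_sq_le (z := fun n => T (useq n)) (mul_pos hα₁ hα₃) hxp hδ
    fun n => by linarith [hest w hw n, hz0 n, hu0 n]
  refine ⟨p, ?_, fun v hv => ?_, hxp⟩
  · rw [hB, hEP, hVI]
    exact ⟨⟨⟨hpC, hTclosed useq (fun n => (huseq n).1) p hpC hup p hTp⟩,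
      ⟨hpC, dual_of_tendsto_resolvent hA2 hfl ha hrn hpC hzseq hzp hxp⟩⟩,
      ⟨hpC, dual_of_tendsto_resolvent hg2 hgl ha hrn hpC huseq hup hxp⟩⟩
  · exact le_of_tendsto (hxp.const_sub x).norm
      (Filter.Eventually.of_forall fun n => hxmin n v (hBsub v hv n))
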